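/- Let $B_r(0)$ be the ball of radius $r>0$ centered at the origin in $\mathbb{C}^n$ and let $\alpha\in(0,1]$. Suppose $u\in C^2(B_r(0))\cap C(\overline{B_r(0)})$ is plurisubharmonic on $B_r(0)$ and satisfies $\det(u_{i\bar j})=f$ in $B_r(0)$ and $u=\varphi$ on $\partial B_r(0)$, where $\varphi\in C^{0,\alpha}(\partial B_r(0))$, $f\geq 0$ and $f^{1/n}\in C^{0,\alpha}(\overline{B_r(0)})$. Then for every $t\in(0,1)$ there is a constant $C=C(n,t)$ depending only on $n$ and $t$ such that $[u]_{0,\alpha;B_{(1-t)r}(0)}\leq C\,([\varphi]_{0,\alpha;\partial B_r(0)}+r^{2-\alpha}|f^{1/n}|'_{0,\alpha;B_r(0)})$. -/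

import Mathlib

open Metric Set
open scoped ComplexOrder

/-- The complex Hessian matrix `(u_{i j̄})` of a function `u : ℂⁿ → ℝ`, where
`u_{i j̄} = ∂²u/∂z_i∂z̄_j = (1/4)(u_{xᵢxⱼ} + u_{yᵢyⱼ} + i (u_{xᵢyⱼ} - u_{yᵢxⱼ}))`,
computed via real Fréchet derivatives. -/
noncomputable def cxHessian (n : ℕ) (u : EuclideanSpace ℂ (Fin n) → ℝ)
    (z : EuclideanSpace ℂ (Fin n)) : Matrix (Fin n) (Fin n) ℂ :=
  Matrix.of fun i j =>
    (1 / 4 : ℂ) *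
      (Complex.ofReal
          ((fderiv ℝ (fun w => fderiv ℝ u w (EuclideanSpace.single j (1 : ℂ))) z)
              (EuclideanSpace.single i (1 : ℂ))
            + (fderiv ℝ (fun w => fderiv ℝ u w (EuclideanSpace.single j Complex.I)) z)
              (EuclideanSpace.single i Complex.I))
        + Complex.I *
          Complex.ofReal
            ((fderiv ℝ (fun w => fderiv ℝ u w (EuclideanSpace.single j Complex.I)) z)
                (EuclideanSpace.single i (1 : ℂ))
              - (fderiv ℝ (fun w => fderiv ℝ u w (EuclideanSpace.single j (1 : ℂ))) z)
                (EuclideanSpace.single i Complex.I)))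

namespace Matrix

variable {m : Type*} [Fintype m] [DecidableEq m]

theorem PosSemidef.card_mul_le_trace_re_of_det_eq_pow {P : Matrix m m ℂ} (hP : P.PosSemidef)
    {q : ℝ} (hq : 0 ≤ q) (hm : 0 < Fintype.card m)
    (hdet : P.det = ((q ^ Fintype.card m : ℝ) : ℂ)) :
    Fintype.card m * q ≤ P.trace.re := by
  have hcard : (0 : ℝ) < Fintype.card m := by exact_mod_cast hm
  have hprod : ∏ i, hP.1.eigenvalues i = q ^ Fintype.card m := by
    have := hP.1.det_eq_prod_eigenvalues
    rw [hdet] at this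
    apply Complex.ofReal_injective
    rw [this]
    simp
  have hsum : P.trace.re = ∑ i, hP.1.eigenvalues i := by
    rw [hP.1.trace_eq_sum_eigenvalues]
    simp
  have hmean := Real.geom_mean_le_arith_mean Finset.univ (fun _ : m => (1 : ℝ))
    hP.1.eigenvalues (by simp) (by simpa using hm) (fun i _ => hP.eigenvalues_nonneg i)
  simp only [Real.rpow_one, one_mul, Finset.sum_const, Finset.card_univ, nsmul_eq_mul, mul_one,
    hprod] at hmean
  rw [Real.pow_rpow_inv_natCast hq hm.ne', le_div_iff₀ hcard] at hmean
  rw [hsum]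
  linarith

theorem PosSemidef.root_det_add_le {H₁ H₂ : Matrix m m ℂ} (hm : 0 < Fintype.card m)
    (h₁ : H₁.PosSemidef) {a : ℝ} (ha : 0 < a) (h : (H₂ - H₁ - (a : ℂ) • 1).PosSemidef)
    {G₁ G₂ : ℝ} (hG₁ : 0 ≤ G₁) (hG₂ : 0 ≤ G₂)
    (hdet₁ : H₁.det = ((G₁ ^ Fintype.card m : ℝ) : ℂ))
    (hdet₂ : H₂.det = ((G₂ ^ Fintype.card m : ℝ) : ℂ)) :
    G₁ + a ≤ G₂ := by
  have hac : (0 : ℂ) < a := by exact_mod_cast ha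
  have hpd : H₂.PosDef := by
    have := ((PosDef.one (n := m) (R := ℂ)).smul hac).posSemidef_add (h.add h₁)
    convert this using 1
    abel
  obtain ⟨B, hB⟩ : ∃ B : Matrix m m ℂ, H₂ = Bᴴ * B := by
    open scoped MatrixOrder in
    exact CStarAlgebra.nonneg_iff_eq_star_mul_self.mp hpd.posSemidef.nonneg
  have hBu : IsUnit B.det := by
    have := hpd.det_pos.ne'
    rw [hB, det_mul] at this
    exact (right_ne_zero_of_mul this).isUnit
  set S := B⁻¹ with hS
  have hSB : B * S = 1 := B.mul_nonsing_inv hBu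
  have hS2 : Sᴴ * H₂ * S = 1 := by
    rw [hB, ← Matrix.mul_assoc, Matrix.mul_assoc _ B S, hSB, Matrix.mul_one, ← conjTranspose_mul,
      hSB, conjTranspose_one]
  have hdetS : ((‖S.det‖ ^ 2 : ℝ) : ℂ) * H₂.det = 1 := by
    have := congrArg det hS2
    rw [det_mul, det_mul, det_conjTranspose, det_one] at this
    rw [← this, Complex.ofReal_pow, ← Complex.conj_mul' S.det]
    simp only [starRingEnd_apply]
    ring
  have hτ : ‖S.det‖ ^ 2 * G₂ ^ Fintype.card m = 1 := by
    rw [hdet₂] at hdetS; exact_mod_cast hdetS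
  have hG₂p : 0 < G₂ := by
    rcases hG₂.eq_or_lt with h0 | h0
    · rw [← h0, zero_pow hm.ne'] at hτ; simp at hτ
    · exact h0
  have hτ' : ‖S.det‖ ^ 2 = (1 / G₂) ^ Fintype.card m := by
    rw [div_pow, one_pow]; field_simp; exact hτ
  have key : ∀ (P : Matrix m m ℂ) (q : ℝ), P.PosSemidef → 0 ≤ q →
      P.det = ((q ^ Fintype.card m : ℝ) : ℂ) →
      Fintype.card m * (q / G₂) ≤ (Sᴴ * P * S).trace.re := by
    intro P q hP hq hd
    refine (hP.conjTranspose_mul_mul_same S).card_mul_le_trace_re_of_det_eq_pow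
      (div_nonneg hq hG₂) hm ?_
    rw [det_mul, det_mul, det_conjTranspose, mul_right_comm, hd]
    have : star S.det * S.det = ((‖S.det‖ ^ 2 : ℝ) : ℂ) := by
      rw [Complex.ofReal_pow, ← Complex.conj_mul' S.det]; rfl
    rw [this, hτ', ← Complex.ofReal_mul, ← mul_pow]
    congr 2; ring
  have k1 := key H₁ G₁ h₁ hG₁ hdet₁
  have k2 := key ((a : ℂ) • 1) a (PosSemidef.one.smul hac.le) ha.le (by simp)
  have k3 := (h.conjTranspose_mul_mul_same S).trace_nonneg
  rw [Matrix.mul_sub, Matrix.mul_sub, Matrix.sub_mul, Matrix.sub_mul, hS2, trace_sub, trace_sub,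
    trace_one, Complex.le_def] at k3
  have k4 := k3.1
  simp only [Complex.zero_re, Complex.sub_re, Complex.natCast_re] at k4
  have hcard : (0 : ℝ) < Fintype.card m := by exact_mod_cast hm
  have : Fintype.card m * ((G₁ + a) / G₂) ≤ Fintype.card m * 1 := by
    rw [add_div, mul_add]; linarith
  have := le_of_mul_le_mul_left this hcard
  rwa [div_le_one hG₂p] at this

end Matrix

theorem IsLocalMax.fderiv_fderiv_apply_self_nonpos {E : Type*} [NormedAddCommGroup E]
    [NormedSpace ℝ E] {f : E → ℝ} {z : E} (h : IsLocalMax f z) (hf : ContDiffAt ℝ 2 f z) (ξ : E) :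
    fderiv ℝ (fderiv ℝ f) z ξ ξ ≤ 0 := by
  by_contra! hpos
  let l : ℝ → E := fun s => z + s • ξ
  have hl : ∀ s, HasDerivAt l ξ s := fun s => by
    simpa [l] using ((hasDerivAt_id s).smul_const ξ).const_add z
  have hl0 : l 0 = z := by simp [l]
  have hlt : Filter.Tendsto l (nhds 0) (nhds z) := by
    simpa [hl0] using (hl 0).continuousAt.tendsto
  have hd : ∀ᶠ w in nhds z, DifferentiableAt ℝ f w :=
    (hf.eventually (by simp)).mono fun w hw => hw.differentiableAt (by norm_num)
  have h1 : deriv (f ∘ l) =ᶠ[nhds 0] fun s => fderiv ℝ f (l s) ξ := by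
    filter_upwards [hlt.eventually hd] with s hs
    exact (hs.hasFDerivAt.comp_hasDerivAt s (hl s)).deriv
  have hff : DifferentiableAt ℝ (fderiv ℝ f) z :=
    (hf.fderiv_right (m := 1) (by norm_num)).differentiableAt (by norm_num)
  have h2 : deriv (deriv (f ∘ l)) 0 = fderiv ℝ (fderiv ℝ f) z ξ ξ := by
    rw [h1.deriv_eq]
    have hff' : HasFDerivAt (fderiv ℝ f) (fderiv ℝ (fderiv ℝ f) z) (l 0) := by
      rw [hl0]; exact hff.hasFDerivAt
    have := (hff'.comp_hasDerivAt 0 (hl 0)).clm_apply (hasDerivAt_const (0 : ℝ) ξ)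
    simpa using this.deriv
  have hmax : IsLocalMax (f ∘ l) 0 := by
    have := hlt.eventually h
    filter_upwards [this] with s hs
    simpa [hl0] using hs
  have hc : ContinuousAt (f ∘ l) 0 :=
    ContinuousAt.comp (by rw [hl0]; exact hf.continuousAt) (hl 0).continuousAt
  have hmin : IsLocalMin (f ∘ l) 0 :=
    isLocalMin_of_deriv_deriv_pos (by rw [h2]; exact hpos) hmax.deriv_eq_zero hc
  have hconst : f ∘ l =ᶠ[nhds 0] fun _ => (f ∘ l) 0 := by
    filter_upwards [hmax, hmin] with s h1 h2 using le_antisymm h1 h2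
  have h3 : deriv (f ∘ l) =ᶠ[nhds 0] fun _ => 0 := by
    simpa using hconst.deriv
  have h4 : deriv (deriv (f ∘ l)) 0 = 0 := by
    simpa using h3.deriv_eq
  rw [h2] at h4
  exact hpos.ne' h4

section LeviForm

variable {E : Type*} [NormedAddCommGroup E] [NormedSpace ℂ E]

/-- The sesquilinear form `∑ ξᵢ η̄ⱼ ∂ᵢ∂̄ⱼ` attached to a real bilinear form. -/
noncomputable def leviForm (B : E →L[ℝ] E →L[ℝ] ℝ) : E →ₗ[ℂ] E →ₛₗ[starRingEnd ℂ] ℂ :=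
  LinearMap.mk₂'ₛₗ (RingHom.id ℂ) (starRingEnd ℂ)
    (fun ξ η => (1 / 4 : ℂ) *
      (Complex.ofReal (B ξ η + B (Complex.I • ξ) (Complex.I • η))
        + Complex.I * Complex.ofReal (B ξ (Complex.I • η) - B (Complex.I • ξ) η)))
    (by intro x y z; simp only [smul_add, map_add, add_apply]; push_cast; ring)
    (by
      intro c x y
      have hc : ∀ w : E, c • w = c.re • w + c.im • (Complex.I • w) := fun w => by
        conv_lhs => rw [← Complex.re_add_im c, add_smul, mul_smul]
        simp
      have hI : ∀ w : E, Complex.I • Complex.I • w = -w := fun w => by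
        rw [smul_smul, Complex.I_mul_I, neg_one_smul]
      rw [smul_comm Complex.I c x, hc x, hc (Complex.I • x)]
      simp only [map_add, add_apply, map_smul, smul_apply, hI, map_neg, neg_apply, smul_eq_mul,
        RingHom.id_apply]
      apply Complex.ext <;> simp <;> ring)
    (by intro x y z; simp only [smul_add, map_add]; push_cast; ring)
    (by
      intro c x y
      have hc : ∀ w : E, c • w = c.re • w + c.im • (Complex.I • w) := fun w => by
        conv_lhs => rw [← Complex.re_add_im c, add_smul, mul_smul]
        simp
      have hI : ∀ w : E, Complex.I • Complex.I • w = -w := fun w => by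
        rw [smul_smul, Complex.I_mul_I, neg_one_smul]
      rw [smul_comm Complex.I c y, hc y, hc (Complex.I • y)]
      simp only [map_add, map_smul, hI, map_neg, smul_eq_mul]
      apply Complex.ext <;> simp <;> ring)

theorem leviForm_apply (B : E →L[ℝ] E →L[ℝ] ℝ) (ξ η : E) :
    leviForm B ξ η = (1 / 4 : ℂ) *
      (Complex.ofReal (B ξ η + B (Complex.I • ξ) (Complex.I • η))
        + Complex.I * Complex.ofReal (B ξ (Complex.I • η) - B (Complex.I • ξ) η)) := rfl

/-- The matrix of `leviForm B` in the standard basis. -/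
noncomputable def leviMatrix (n : ℕ)
    (B : EuclideanSpace ℂ (Fin n) →L[ℝ] EuclideanSpace ℂ (Fin n) →L[ℝ] ℝ) :
    Matrix (Fin n) (Fin n) ℂ :=
  Matrix.of fun i j =>
    leviForm B (EuclideanSpace.single i (1 : ℂ)) (EuclideanSpace.single j (1 : ℂ))

theorem EuclideanSpace.sum_smul_single {n : ℕ} (x : EuclideanSpace ℂ (Fin n)) :
    ∑ i, x i • EuclideanSpace.single i (1 : ℂ) = x := by
  ext j
  simp [Finset.sum_apply, Pi.single_apply]

theorem leviForm_eq_sum {n : ℕ}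
    (B : EuclideanSpace ℂ (Fin n) →L[ℝ] EuclideanSpace ℂ (Fin n) →L[ℝ] ℝ)
    (ξ η : EuclideanSpace ℂ (Fin n)) :
    leviForm B ξ η = ∑ i, ∑ j, ξ i * starRingEnd ℂ (η j) * leviMatrix n B i j := by
  conv_lhs => rw [← EuclideanSpace.sum_smul_single ξ, ← EuclideanSpace.sum_smul_single η]
  simp only [map_sum, LinearMap.sum_apply, map_smulₛₗ, LinearMap.smul_apply, smul_eq_mul,
    RingHom.id_apply, leviMatrix, Matrix.of_apply, Finset.mul_sum]
  rw [Finset.sum_comm]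
  refine Finset.sum_congr rfl fun i _ => Finset.sum_congr rfl fun j _ => ?_
  ring

theorem leviMatrix_posSemidef {n : ℕ}
    {B : EuclideanSpace ℂ (Fin n) →L[ℝ] EuclideanSpace ℂ (Fin n) →L[ℝ] ℝ}
    (hsymm : ∀ x y, B x y = B y x) (hnonneg : ∀ x, 0 ≤ B x x) :
    (leviMatrix n B).PosSemidef := by
  refine Matrix.PosSemidef.of_dotProduct_mulVec_nonneg ?_ fun x => ?_
  · ext i j
    simp only [leviMatrix, Matrix.conjTranspose_apply, Matrix.of_apply, leviForm_apply]
    rw [hsymm (EuclideanSpace.single j (1 : ℂ)) (EuclideanSpace.single i (1 : ℂ)),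
      hsymm (Complex.I • EuclideanSpace.single j (1 : ℂ))
        (Complex.I • EuclideanSpace.single i (1 : ℂ)),
      hsymm (EuclideanSpace.single j (1 : ℂ)) (Complex.I • EuclideanSpace.single i (1 : ℂ)),
      hsymm (Complex.I • EuclideanSpace.single j (1 : ℂ)) (EuclideanSpace.single i (1 : ℂ))]
    simp only [Complex.star_def]
    apply Complex.ext <;> simp
  · set ξ : EuclideanSpace ℂ (Fin n) := WithLp.toLp 2 (star x) with hξ
    have hval : star x ⬝ᵥ (leviMatrix n B).mulVec x = leviForm B ξ ξ := by
      rw [leviForm_eq_sum]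
      simp only [dotProduct, Matrix.mulVec, Finset.mul_sum]
      refine Finset.sum_congr rfl fun i _ => Finset.sum_congr rfl fun j _ => ?_
      simp [hξ]
      ring
    rw [hval, leviForm_apply, hsymm ξ (Complex.I • ξ), sub_self, Complex.ofReal_zero, mul_zero,
      add_zero]
    have : (0 : ℝ) ≤ 1 / 4 * (B ξ ξ + B (Complex.I • ξ) (Complex.I • ξ)) := by
      have := hnonneg ξ
      have := hnonneg (Complex.I • ξ)
      positivity
    have h := Complex.zero_le_real.2 this
    push_cast at h ⊢
    exact h

end LeviForm

theorem cxHessian_eq_leviMatrix {n : ℕ} {u : EuclideanSpace ℂ (Fin n) → ℝ}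
    {z : EuclideanSpace ℂ (Fin n)} (hu : DifferentiableAt ℝ (fderiv ℝ u) z) :
    cxHessian n u z = leviMatrix n (fderiv ℝ (fderiv ℝ u) z) := by
  have hI : ∀ i : Fin n, Complex.I • EuclideanSpace.single i (1 : ℂ)
      = EuclideanSpace.single i Complex.I := fun i => by
    ext j; simp
  have hd : ∀ ξ η : EuclideanSpace ℂ (Fin n),
      fderiv ℝ (fun w => fderiv ℝ u w η) z ξ = fderiv ℝ (fderiv ℝ u) z ξ η := fun ξ η => by
    have := (hu.hasFDerivAt.clm_apply (hasFDerivAt_const η z)).fderiv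
    rw [this]; simp
  ext i j
  simp only [cxHessian, leviMatrix, Matrix.of_apply, leviForm_apply, hI, hd]

theorem ContDiffAt.differentiableAt_fderiv {E : Type*} [NormedAddCommGroup E]
    [NormedSpace ℝ E] {f : E → ℝ} {z : E} (hf : ContDiffAt ℝ 2 f z) :
    DifferentiableAt ℝ (fderiv ℝ f) z :=
  (hf.fderiv_right (m := 1) (by norm_num)).differentiableAt (by norm_num)

theorem cxHessian_sub_posSemidef_of_isLocalMax {n : ℕ} {v₁ v₂ : EuclideanSpace ℂ (Fin n) → ℝ}
    {z : EuclideanSpace ℂ (Fin n)} (h₁ : ContDiffAt ℝ 2 v₁ z) (h₂ : ContDiffAt ℝ 2 v₂ z) {a : ℝ}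
    (h : IsLocalMax (fun w => v₁ w + a * ‖w‖ ^ 2 - v₂ w) z) :
    (cxHessian n v₂ z - cxHessian n v₁ z - (a : ℂ) • 1).PosSemidef := by
  set N : EuclideanSpace ℂ (Fin n) →L[ℝ] EuclideanSpace ℂ (Fin n) →L[ℝ] ℝ := 2 • innerSL ℝ
  set f : EuclideanSpace ℂ (Fin n) → ℝ := fun w => v₁ w + a * ‖w‖ ^ 2 - v₂ w with hf_def
  have hf : ContDiffAt ℝ 2 f z :=
    (h₁.add (contDiffAt_const.mul (contDiff_norm_sq ℝ).contDiffAt)).sub h₂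
  have hd₁ : ∀ᶠ w in nhds z, DifferentiableAt ℝ v₁ w :=
    (h₁.eventually (by simp)).mono fun w hw => hw.differentiableAt (by norm_num)
  have hd₂ : ∀ᶠ w in nhds z, DifferentiableAt ℝ v₂ w :=
    (h₂.eventually (by simp)).mono fun w hw => hw.differentiableAt (by norm_num)
  have e1 : fderiv ℝ f =ᶠ[nhds z] fun w => fderiv ℝ v₁ w + a • N w - fderiv ℝ v₂ w := by
    filter_upwards [hd₁, hd₂] with w hw₁ hw₂
    have hN : HasFDerivAt (fun w : EuclideanSpace ℂ (Fin n) => a * ‖w‖ ^ 2) (a • N w) w :=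
      (hasStrictFDerivAt_norm_sq w).hasFDerivAt.const_mul a
    exact ((hw₁.hasFDerivAt.add hN).sub hw₂.hasFDerivAt).fderiv
  have e2 : fderiv ℝ (fderiv ℝ f) z
      = fderiv ℝ (fderiv ℝ v₁) z + a • N - fderiv ℝ (fderiv ℝ v₂) z := by
    rw [e1.fderiv_eq]
    exact ((h₁.differentiableAt_fderiv.hasFDerivAt.add (N.hasFDerivAt.const_smul a)).sub
      h₂.differentiableAt_fderiv.hasFDerivAt).fderiv
  have hle := h.fderiv_fderiv_apply_self_nonpos hf
  have hsymm := hf.isSymmSndFDerivAt (by simp)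
  have key : cxHessian n v₂ z - cxHessian n v₁ z - (a : ℂ) • 1
      = leviMatrix n (-fderiv ℝ (fderiv ℝ f) z) := by
    rw [cxHessian_eq_leviMatrix h₁.differentiableAt_fderiv,
      cxHessian_eq_leviMatrix h₂.differentiableAt_fderiv, e2]
    have hN : leviMatrix n N = 1 := by
      have hin : ∀ x y, N x y = 2 * (∑ k, starRingEnd ℂ (x k) * y k).re := fun x y => by
        have : N x y = 2 * inner ℝ x y := by
          simp only [N, smul_apply, nsmul_eq_mul, Nat.cast_ofNat]
          rfl
        simp [this, PiLp.inner_apply, Complex.inner, mul_comm, -Complex.mul_re]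
      ext i j
      rcases eq_or_ne i j with rfl | hij
      · simp [leviMatrix, leviForm_apply, hin, -map_smul, -Complex.mul_re]
        norm_num
      · simp [leviMatrix, leviForm_apply, hin, hij, hij.symm, -map_smul, -Complex.mul_re]
    rw [← hN]
    ext i j
    simp only [leviMatrix, leviForm_apply, Matrix.sub_apply, Matrix.smul_apply, Matrix.of_apply,
      neg_apply, add_apply, sub_apply, smul_apply, smul_eq_mul]
    push_cast
    ring
  rw [key]
  exact leviMatrix_posSemidef (fun x y => by simpa using hsymm x y)
    (fun x => by simpa using hle x)

theorem cxHessian_comp {n : ℕ} {u : EuclideanSpace ℂ (Fin n) → ℝ}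
    {F : EuclideanSpace ℂ (Fin n) → EuclideanSpace ℂ (Fin n)} {z : EuclideanSpace ℂ (Fin n)}
    (hu : ContDiffAt ℝ 2 u (F z)) (hF : ContDiffAt ℂ 2 F z)
    {J : Matrix (Fin n) (Fin n) ℂ}
    (hJ : ∀ k i, fderiv ℂ F z (EuclideanSpace.single i (1 : ℂ)) k = J k i) :
    cxHessian n (u ∘ F) z = J.transpose * cxHessian n u (F z) * J.map (starRingEnd ℂ) := by
  have hFd : ∀ᶠ w in nhds z, DifferentiableAt ℂ F w :=
    (hF.eventually (by simp)).mono fun w hw => hw.differentiableAt (by norm_num)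
  have hud : ∀ᶠ w in nhds z, DifferentiableAt ℝ u (F w) :=
    hF.continuousAt.eventually
      ((hu.eventually (by simp)).mono fun w hw => hw.differentiableAt (by norm_num))
  have hG : DifferentiableAt ℂ (fderiv ℂ F) z :=
    (hF.fderiv_right (m := 1) (by norm_num)).differentiableAt (by norm_num)
  have hv : ContDiffAt ℝ 2 (u ∘ F) z := hu.comp z (hF.restrict_scalars ℝ)
  set B := fderiv ℝ (fderiv ℝ u) (F z)
  set G := fderiv ℂ F z
  set G' := fderiv ℂ (fderiv ℂ F) z
  set l := fderiv ℝ u (F z)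
  have hsnd : ∀ ξ η, fderiv ℝ (fderiv ℝ (u ∘ F)) z ξ η = B (G ξ) (G η) + l (G' ξ η) := by
    intro ξ η
    have e1 : (fun w => fderiv ℝ (u ∘ F) w η)
        =ᶠ[nhds z] fun w => fderiv ℝ u (F w) (fderiv ℂ F w η) := by
      filter_upwards [hFd, hud] with w hw hw'
      rw [(hw'.hasFDerivAt.comp w (hw.hasFDerivAt.restrictScalars ℝ)).fderiv]
      rfl
    have e2 : HasFDerivAt (fun w => fderiv ℝ (u ∘ F) w η)
        ((ContinuousLinearMap.apply ℝ ℝ η).comp (fderiv ℝ (fderiv ℝ (u ∘ F)) z)) z :=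
      (ContinuousLinearMap.apply ℝ ℝ η).hasFDerivAt.comp z
        hv.differentiableAt_fderiv.hasFDerivAt
    have e3 := (hG.hasFDerivAt.clm_apply (hasFDerivAt_const η z)).restrictScalars ℝ
    have e4 : HasFDerivAt (fun w => fderiv ℝ u (F w)) (B.comp (G.restrictScalars ℝ)) z :=
      hu.differentiableAt_fderiv.hasFDerivAt.comp z
        ((hFd.self_of_nhds).hasFDerivAt.restrictScalars ℝ)
    have e5 := (e4.clm_apply e3).congr_of_eventuallyEq e1
    have := congrArg (fun L => L ξ) (e2.unique e5)
    simp only [ContinuousLinearMap.comp_apply, ContinuousLinearMap.apply_apply, add_apply,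
      ContinuousLinearMap.flip_apply, ContinuousLinearMap.coe_restrictScalars'] at this
    rw [this, zero_apply, map_zero, zero_add]
    exact add_comm _ _
  have hQ : ∀ ξ η, leviForm (fderiv ℝ (fderiv ℝ (u ∘ F)) z) ξ η = leviForm B (G ξ) (G η) := by
    intro ξ η
    simp only [leviForm_apply, hsnd, map_smul, smul_apply, smul_smul, Complex.I_mul_I, neg_one_smul,
      map_neg]
    push_cast
    ring
  rw [cxHessian_eq_leviMatrix hv.differentiableAt_fderiv,
    cxHessian_eq_leviMatrix hu.differentiableAt_fderiv]
  ext i j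
  have : leviMatrix n (fderiv ℝ (fderiv ℝ (u ∘ F)) z) i j
    = leviForm B (G (EuclideanSpace.single i (1 : ℂ))) (G (EuclideanSpace.single j (1 : ℂ))) :=
    hQ _ _
  rw [this, leviForm_eq_sum]
  simp only [hJ, Matrix.mul_apply, Matrix.transpose_apply, Matrix.map_apply, Finset.sum_mul]
  rw [Finset.sum_comm]
  refine Finset.sum_congr rfl fun k _ => Finset.sum_congr rfl fun l _ => ?_
  ring

/-- The involutive automorphism of the unit ball of `ℂⁿ` exchanging `0` and `a`. -/
noncomputable def ballInvolution {n : ℕ} (a z : EuclideanSpace ℂ (Fin n)) :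
    EuclideanSpace ℂ (Fin n) :=
  (1 - inner ℂ a z)⁻¹ • (a - (√(1 - ‖a‖ ^ 2) : ℂ) • z
    - ((1 + √(1 - ‖a‖ ^ 2) : ℂ)⁻¹ * inner ℂ a z) • a)

section ballInvolution

variable {n : ℕ} {a z : EuclideanSpace ℂ (Fin n)}

@[simp]
theorem ballInvolution_zero (a : EuclideanSpace ℂ (Fin n)) : ballInvolution a 0 = a := by
  simp [ballInvolution]

theorem one_sub_inner_ne_zero (ha : ‖a‖ < 1) (hz : ‖z‖ ≤ 1) : 1 - inner ℂ a z ≠ 0 := by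
  intro h
  have h1 : ‖inner ℂ a z‖ ≤ ‖a‖ * ‖z‖ := norm_inner_le_norm a z
  rw [← sub_eq_zero.mp h, norm_one] at h1
  nlinarith [norm_nonneg a, norm_nonneg z]

theorem one_sub_norm_sq_pos (ha : ‖a‖ < 1) : 0 < 1 - ‖a‖ ^ 2 := by
  nlinarith [norm_nonneg a]

theorem one_add_sqrt_ne_zero (x : ℝ) : (1 + √x : ℂ) ≠ 0 := by
  have : (0 : ℝ) < 1 + √x := by positivity
  exact_mod_cast this.ne'

theorem one_sub_norm_sq_ballInvolution (ha : ‖a‖ < 1) (hz : ‖z‖ ≤ 1) :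
    (1 - ‖ballInvolution a z‖ ^ 2) * ‖1 - inner ℂ a z‖ ^ 2 = (1 - ‖a‖ ^ 2) * (1 - ‖z‖ ^ 2) := by
  have hne := one_sub_inner_ne_zero ha hz
  have hs2 := Real.sq_sqrt (one_sub_norm_sq_pos ha).le
  have hs0 : (0 : ℝ) < 1 + √(1 - ‖a‖ ^ 2) := by positivity
  rw [ballInvolution, norm_smul, norm_inv]
  set s : ℝ := √(1 - ‖a‖ ^ 2) with hs
  set ζ : ℂ := inner ℂ a z with hζ
  have hn : ‖a - (s : ℂ) • z - ((1 + s : ℂ)⁻¹ * ζ) • a‖ ^ 2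
      = (1 - s ^ 2) * ((1 - ζ.re / (1 + s)) ^ 2 + (ζ.im / (1 + s)) ^ 2) + s ^ 2 * ‖z‖ ^ 2
        - 2 * s * (ζ.re - (ζ.re ^ 2 + ζ.im ^ 2) / (1 + s)) := by
    obtain ⟨x, hx⟩ : ∃ x, x = ζ.re / (1 + s) := ⟨_, rfl⟩
    obtain ⟨y, hy⟩ : ∃ y, y = ζ.im / (1 + s) := ⟨_, rfl⟩
    have e1 : a - (s : ℂ) • z - ((1 + s : ℂ)⁻¹ * ζ) • a
        = (1 - (x + y * Complex.I) : ℂ) • a - (s : ℂ) • z := by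
      have : (1 + s : ℂ)⁻¹ * ζ = x + y * Complex.I := by
        conv_lhs => rw [← Complex.re_add_im ζ]
        rw [hx, hy]; push_cast; ring
      rw [this, sub_smul, one_smul]; abel
    have ha2 : ‖a‖ ^ 2 = 1 - s ^ 2 := by rw [hs2]; ring
    rw [e1, norm_sub_sq (𝕜 := ℂ), norm_smul, norm_smul, mul_pow, mul_pow, inner_smul_left,
      inner_smul_right, ← hζ, ← Complex.normSq_eq_norm_sq, ← Complex.normSq_eq_norm_sq,
      Complex.normSq_apply, Complex.normSq_apply, ha2, ← hx, ← hy]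
    have hx' : ζ.re = x * (1 + s) := by rw [hx]; field_simp
    have hy' : ζ.im = y * (1 + s) := by rw [hy]; field_simp
    simp only [RCLike.re_to_complex, map_sub, map_one, map_add, map_mul, Complex.conj_ofReal,
      Complex.conj_I, Complex.mul_re, Complex.mul_im, Complex.sub_re, Complex.sub_im,
      Complex.add_re, Complex.add_im, Complex.neg_re, Complex.neg_im, Complex.one_re,
      Complex.one_im, Complex.ofReal_re, Complex.ofReal_im, Complex.I_re, Complex.I_im, hx', hy']
    field_simp
    ring
  have hd : ‖1 - ζ‖ ^ 2 = (1 - ζ.re) ^ 2 + ζ.im ^ 2 := by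
    rw [← Complex.normSq_eq_norm_sq, Complex.normSq_apply]; simp; ring
  have hd0 : ‖1 - ζ‖ ^ 2 ≠ 0 := pow_ne_zero _ (norm_ne_zero_iff.mpr hne)
  rw [mul_pow, inv_pow, sub_mul, mul_right_comm, inv_mul_cancel₀ hd0, one_mul, one_mul, hn, hd,
    ← hs2]
  field_simp
  ring

theorem norm_ballInvolution_lt_one (ha : ‖a‖ < 1) (hz : ‖z‖ < 1) : ‖ballInvolution a z‖ < 1 := by
  have h := one_sub_norm_sq_ballInvolution ha hz.le
  have h1 := mul_pos (one_sub_norm_sq_pos ha) (one_sub_norm_sq_pos hz)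
  rw [← h] at h1
  have h2 := pos_of_mul_pos_left h1 (by positivity)
  nlinarith [norm_nonneg (ballInvolution a z)]

theorem norm_ballInvolution_eq_one (ha : ‖a‖ < 1) (hz : ‖z‖ = 1) : ‖ballInvolution a z‖ = 1 := by
  have h := one_sub_norm_sq_ballInvolution ha hz.le
  rw [hz] at h
  have hne : ‖1 - inner ℂ a z‖ ^ 2 ≠ 0 :=
    pow_ne_zero _ (norm_ne_zero_iff.mpr (one_sub_inner_ne_zero ha hz.le))
  have h2 : 1 - ‖ballInvolution a z‖ ^ 2 = 0 := by
    refine (mul_eq_zero.mp (h.trans ?_)).resolve_right hne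
    ring
  nlinarith [norm_nonneg (ballInvolution a z)]

theorem contDiffAt_ballInvolution {k : WithTop ℕ∞} (ha : ‖a‖ < 1) (hz : ‖z‖ ≤ 1) :
    ContDiffAt ℂ k (ballInvolution a) z := by
  have hi : ContDiffAt ℂ k (fun w => inner ℂ a w) z := (innerSL ℂ a).contDiff.contDiffAt
  have h1 : ContDiffAt ℂ k (fun w => (1 - inner ℂ a w)⁻¹) z :=
    (contDiffAt_const.sub hi).inv (one_sub_inner_ne_zero ha hz)
  have h2 : ContDiffAt ℂ k (fun w => ((1 + √(1 - ‖a‖ ^ 2) : ℂ)⁻¹ * inner ℂ a w) • a) z :=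
    (contDiffAt_const.mul hi).smul contDiffAt_const
  have h3 : ContDiffAt ℂ k (fun w => a - (√(1 - ‖a‖ ^ 2) : ℂ) • w) z :=
    contDiffAt_const.sub (contDiffAt_id.const_smul _)
  exact h1.smul (h3.sub h2)

theorem fderiv_ballInvolution (ha : ‖a‖ < 1) (hz : ‖z‖ ≤ 1) (ξ : EuclideanSpace ℂ (Fin n)) :
    fderiv ℂ (ballInvolution a) z ξ = (1 - inner ℂ a z)⁻¹ • (inner ℂ a ξ • (ballInvolution a z
      - (1 + √(1 - ‖a‖ ^ 2) : ℂ)⁻¹ • a) - (√(1 - ‖a‖ ^ 2) : ℂ) • ξ) := by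
  have hne := one_sub_inner_ne_zero ha hz
  have hi : HasFDerivAt (fun w => inner ℂ a w) (innerSL ℂ a) z := (innerSL ℂ a).hasFDerivAt
  have h1 := (hasFDerivAt_inv hne).comp z (hi.const_sub 1)
  have h2 := (((hasFDerivAt_id (𝕜 := ℂ) z).const_smul (√(1 - ‖a‖ ^ 2) : ℂ)).const_sub a).sub
    ((hi.const_mul (1 + √(1 - ‖a‖ ^ 2) : ℂ)⁻¹).smul_const a)
  have h3 := (h1.smul h2).fderiv
  have h4 := congrArg (fun L => L ξ) h3
  refine Eq.trans h4 ?_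
  simp only [ballInvolution]
  simp
  rw [← inv_pow]
  module

theorem norm_det_ballInvolution_sq (ha : ‖a‖ < 1) (hz : ‖z‖ ≤ 1) (r : ℝ)
    {J : Matrix (Fin n) (Fin n) ℂ}
    (hJ : ∀ k i, J k i = r * fderiv ℂ (ballInvolution a) z (EuclideanSpace.single i (1 : ℂ)) k) :
    ‖J.det‖ ^ 2 = (r ^ 2) ^ n * ((1 - ‖a‖ ^ 2) / ‖1 - inner ℂ a z‖ ^ 2) ^ (n + 1) := by
  have hne := one_sub_inner_ne_zero ha hz
  have hs2 := Real.sq_sqrt (one_sub_norm_sq_pos ha).le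
  have hs0 := Real.sqrt_pos.2 (one_sub_norm_sq_pos ha)
  have hs1 := one_add_sqrt_ne_zero (1 - ‖a‖ ^ 2)
  set s : ℝ := √(1 - ‖a‖ ^ 2) with hs
  have hsc : (s : ℂ) ≠ 0 := by exact_mod_cast hs0.ne'
  set ζ : ℂ := inner ℂ a z with hζ
  set p : EuclideanSpace ℂ (Fin n) := ballInvolution a z - (1 + s : ℂ)⁻¹ • a with hp
  have haa : inner ℂ a a = (1 : ℂ) - s ^ 2 := by
    rw [inner_self_eq_norm_sq_to_K, ← Complex.ofReal_pow s, hs2]; simp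
  have hap : inner ℂ a p = s - s ^ 2 / (1 - ζ) := by
    rw [hp, inner_sub_right, inner_smul_right, ballInvolution, inner_smul_right, inner_sub_right,
      inner_sub_right, inner_smul_right, inner_smul_right, ← hs, ← hζ, haa]
    field_simp
    ring
  have hJeq : J = (-(r * s) * (1 - ζ)⁻¹ : ℂ) • (1 + Matrix.replicateCol Unit (fun k => -p k / s)
      * Matrix.replicateRow Unit (fun i => starRingEnd ℂ (a i))) := by
    ext k i
    rw [hJ, fderiv_ballInvolution ha hz]
    simp [Matrix.mul_apply, Matrix.one_apply, EuclideanSpace.inner_single_right, ← hs, ← hp, ← hζ]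
    split_ifs <;> field_simp <;> ring
  have hdot : (fun i => starRingEnd ℂ (a i)) ⬝ᵥ (fun k => -p k / (s : ℂ)) = -inner ℂ a p / s := by
    simp [dotProduct, PiLp.inner_apply, Finset.sum_div, ← Finset.sum_neg_distrib]
    refine Finset.sum_congr rfl fun i _ => ?_
    ring
  have hdet : J.det = (-(r * s) * (1 - ζ)⁻¹ : ℂ) ^ n * (s * (1 - ζ)⁻¹) := by
    rw [hJeq, Matrix.det_smul, Matrix.det_one_add_replicateCol_mul_replicateRow, hdot, hap,
      Fintype.card_fin]
    congr 1
    field_simp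
    ring
  rw [hdet, ← hs2]
  simp only [norm_mul, norm_pow, norm_neg, norm_inv, Complex.norm_real, Real.norm_eq_abs]
  rw [abs_of_pos hs0, pow_succ, div_pow, ← sq_abs r]
  simp only [mul_pow, inv_pow, ← pow_mul]
  field_simp
  ring

end ballInvolution

/-- The `n`-th root of the squared modulus of the Jacobian determinant of `ballInvolution a`
at `z`. -/
noncomputable def ballInvolutionWeight {n : ℕ} (a z : EuclideanSpace ℂ (Fin n)) : ℝ :=
  ((1 - ‖a‖ ^ 2) / ‖1 - inner ℂ a z‖ ^ 2) ^ ((n + 1) / n : ℝ)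

section Lipschitz

variable {n : ℕ}

theorem ballInvolutionWeight_nonneg {a z : EuclideanSpace ℂ (Fin n)} (ha : ‖a‖ < 1) :
    0 ≤ ballInvolutionWeight a z :=
  Real.rpow_nonneg (div_nonneg (one_sub_norm_sq_pos ha).le (by positivity)) _

theorem ballInvolutionWeight_pow (hn : 0 < n) {a z : EuclideanSpace ℂ (Fin n)} (ha : ‖a‖ < 1) :
    ballInvolutionWeight a z ^ n = ((1 - ‖a‖ ^ 2) / ‖1 - inner ℂ a z‖ ^ 2) ^ (n + 1) := by
  have hn' : (n : ℝ) ≠ 0 := by exact_mod_cast hn.ne'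
  rw [ballInvolutionWeight, ← Real.rpow_natCast, ← Real.rpow_mul
    (div_nonneg (one_sub_norm_sq_pos ha).le (by positivity)), div_mul_cancel₀ _ hn']
  exact_mod_cast Real.rpow_natCast _ (n + 1)

theorem contDiffAt_uncurry_ballInvolution
    {q : EuclideanSpace ℂ (Fin n) × EuclideanSpace ℂ (Fin n)} (ha : ‖q.1‖ < 1) (hz : ‖q.2‖ ≤ 1) :
    ContDiffAt ℝ 1 (fun q => ballInvolution q.1 q.2) q := by
  have hi : ContDiffAt ℝ 1 (fun q : EuclideanSpace ℂ (Fin n) × EuclideanSpace ℂ (Fin n) =>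
      (inner ℂ q.1 q.2 : ℂ)) q := contDiffAt_fst.inner ℂ contDiffAt_snd
  have hs : ContDiffAt ℝ 1 (fun q : EuclideanSpace ℂ (Fin n) × EuclideanSpace ℂ (Fin n) =>
      √(1 - ‖q.1‖ ^ 2)) q :=
    (contDiffAt_const.sub (contDiffAt_fst.norm_sq ℂ)).sqrt (one_sub_norm_sq_pos ha).ne'
  have hsc : ContDiffAt ℝ 1 (fun q : EuclideanSpace ℂ (Fin n) × EuclideanSpace ℂ (Fin n) =>
      (√(1 - ‖q.1‖ ^ 2) : ℂ)) q := Complex.ofRealCLM.contDiff.contDiffAt.comp q hs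
  have h1 : ContDiffAt ℝ 1 (fun q : EuclideanSpace ℂ (Fin n) × EuclideanSpace ℂ (Fin n) =>
      (1 - inner ℂ q.1 q.2 : ℂ)⁻¹) q :=
    (contDiffAt_const.sub hi).inv (one_sub_inner_ne_zero ha hz)
  have h2 : ContDiffAt ℝ 1 (fun q : EuclideanSpace ℂ (Fin n) × EuclideanSpace ℂ (Fin n) =>
      ((1 + √(1 - ‖q.1‖ ^ 2) : ℂ)⁻¹ * inner ℂ q.1 q.2) • q.1) q :=
    (((contDiffAt_const.add hsc).inv (one_add_sqrt_ne_zero _)).mul hi).smul contDiffAt_fst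
  have h3 : ContDiffAt ℝ 1 (fun q : EuclideanSpace ℂ (Fin n) × EuclideanSpace ℂ (Fin n) =>
      q.1 - (√(1 - ‖q.1‖ ^ 2) : ℂ) • q.2) q :=
    contDiffAt_fst.sub (hsc.smul contDiffAt_snd)
  exact h1.smul (h3.sub h2)

theorem contDiffAt_uncurry_ballInvolutionWeight
    {q : EuclideanSpace ℂ (Fin n) × EuclideanSpace ℂ (Fin n)} (ha : ‖q.1‖ < 1) (hz : ‖q.2‖ ≤ 1) :
    ContDiffAt ℝ 1 (fun q => ballInvolutionWeight q.1 q.2) q := by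
  have hne := one_sub_inner_ne_zero ha hz
  have hi : ContDiffAt ℝ 1 (fun q : EuclideanSpace ℂ (Fin n) × EuclideanSpace ℂ (Fin n) =>
      ‖(1 - inner ℂ q.1 q.2 : ℂ)‖ ^ 2) q :=
    (contDiffAt_const.sub (contDiffAt_fst.inner ℂ contDiffAt_snd)).norm_sq ℂ
  have hs : ContDiffAt ℝ 1 (fun q : EuclideanSpace ℂ (Fin n) × EuclideanSpace ℂ (Fin n) =>
      1 - ‖q.1‖ ^ 2) q := contDiffAt_const.sub (contDiffAt_fst.norm_sq ℂ)
  have hpos : 0 < ‖(1 - inner ℂ q.1 q.2 : ℂ)‖ ^ 2 := by positivity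
  exact (hs.div hi hpos.ne').rpow_const_of_ne (div_pos (one_sub_norm_sq_pos ha) hpos).ne'

theorem exists_ballInvolution_bounds (n : ℕ) {ρ : ℝ} (hρ : ρ < 1) :
    ∃ L : ℝ, 1 ≤ L ∧ ∀ a b z : EuclideanSpace ℂ (Fin n), ‖a‖ ≤ ρ → ‖b‖ ≤ ρ → ‖z‖ ≤ 1 →
      ‖ballInvolution a z - ballInvolution b z‖ ≤ L * ‖a - b‖ ∧
      |ballInvolutionWeight a z - ballInvolutionWeight b z| ≤ L * ‖a - b‖ ∧
      ballInvolutionWeight a z ≤ L := by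
  set S : Set (EuclideanSpace ℂ (Fin n) × EuclideanSpace ℂ (Fin n)) :=
    closedBall 0 ρ ×ˢ closedBall 0 1 with hS
  have hconv : Convex ℝ S := (convex_closedBall _ _).prod (convex_closedBall _ _)
  have hcomp : IsCompact S := (isCompact_closedBall _ _).prod (isCompact_closedBall _ _)
  have hmem : ∀ q ∈ S, ‖q.1‖ < 1 ∧ ‖q.2‖ ≤ 1 := fun q hq => by
    simp only [hS, mem_prod, mem_closedBall_zero_iff] at hq
    exact ⟨hq.1.trans_lt hρ, hq.2⟩
  have c1 : ContDiffOn ℝ 1 (fun q : EuclideanSpace ℂ (Fin n) × EuclideanSpace ℂ (Fin n) =>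
      ballInvolution q.1 q.2) S := fun q hq =>
    (contDiffAt_uncurry_ballInvolution (hmem q hq).1 (hmem q hq).2).contDiffWithinAt
  have c2 : ContDiffOn ℝ 1 (fun q : EuclideanSpace ℂ (Fin n) × EuclideanSpace ℂ (Fin n) =>
      ballInvolutionWeight q.1 q.2) S := fun q hq =>
    (contDiffAt_uncurry_ballInvolutionWeight (hmem q hq).1 (hmem q hq).2).contDiffWithinAt
  obtain ⟨K₁, hK₁⟩ := c1.exists_lipschitzOnWith (by norm_num) hconv hcomp
  obtain ⟨K₂, hK₂⟩ := c2.exists_lipschitzOnWith (by norm_num) hconv hcomp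
  obtain ⟨M, hM⟩ := hcomp.exists_bound_of_continuousOn c2.continuousOn
  refine ⟨1 + K₁ + K₂ + |M|, by have := abs_nonneg M; linarith [K₁.2, K₂.2, K₁.coe_nonneg,
    K₂.coe_nonneg], fun a b z ha hb hz => ?_⟩
  have haz : (a, z) ∈ S := by simp [hS, ha, hz]
  have hbz : (b, z) ∈ S := by simp [hS, hb, hz]
  have hdist : dist (a, z) (b, z) = ‖a - b‖ := by simp [dist_eq_norm]
  have l1 := hK₁.dist_le_mul _ haz _ hbz
  have l2 := hK₂.dist_le_mul _ haz _ hbz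
  have l3 := hM _ haz
  rw [hdist, dist_eq_norm] at l1 l2
  rw [Real.norm_eq_abs] at l2 l3
  have hnn := norm_nonneg (a - b)
  have hM0 := abs_nonneg M
  have h1 := K₁.coe_nonneg
  have h2 := K₂.coe_nonneg
  refine ⟨l1.trans (mul_le_mul_of_nonneg_right (by linarith) hnn),
    l2.trans (mul_le_mul_of_nonneg_right (by linarith) hnn),
    (le_abs_self _).trans (l3.trans ?_)⟩
  linarith [le_abs_self M]

end Lipschitz

section Dirichlet

variable {n : ℕ} {u g : EuclideanSpace ℂ (Fin n) → ℝ} {a z : EuclideanSpace ℂ (Fin n)} {r : ℝ}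

theorem smul_ballInvolution_mem_ball (hr : 0 < r) (ha : ‖a‖ < 1) (hz : ‖z‖ < 1) :
    r • ballInvolution a z ∈ ball (0 : EuclideanSpace ℂ (Fin n)) r := by
  rw [mem_ball_zero_iff, norm_smul, Real.norm_of_nonneg hr.le]
  exact mul_lt_of_lt_one_right hr (norm_ballInvolution_lt_one ha hz)

theorem smul_ballInvolution_mem_sphere (hr : 0 < r) (ha : ‖a‖ < 1) (hz : ‖z‖ = 1) :
    r • ballInvolution a z ∈ sphere (0 : EuclideanSpace ℂ (Fin n)) r := by
  rw [mem_sphere_zero_iff_norm, norm_smul, Real.norm_of_nonneg hr.le,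
    norm_ballInvolution_eq_one ha hz, mul_one]

theorem smul_ballInvolution_mem_closedBall (hr : 0 < r) (ha : ‖a‖ < 1) (hz : ‖z‖ ≤ 1) :
    r • ballInvolution a z ∈ closedBall (0 : EuclideanSpace ℂ (Fin n)) r := by
  rcases hz.lt_or_eq with h | h
  · exact ball_subset_closedBall (smul_ballInvolution_mem_ball hr ha h)
  · exact sphere_subset_closedBall (smul_ballInvolution_mem_sphere hr ha h)

theorem contDiffAt_comp_smul_ballInvolution (hr : 0 < r) (hu : ContDiffOn ℝ 2 u (ball 0 r))
    (ha : ‖a‖ < 1) (hz : ‖z‖ < 1) :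
    ContDiffAt ℝ 2 (fun w => u (r • ballInvolution a w)) z :=
  ContDiffAt.comp z (g := u)
    (hu.contDiffAt (isOpen_ball.mem_nhds (smul_ballInvolution_mem_ball hr ha hz)))
    (((contDiffAt_ballInvolution ha hz.le).restrict_scalars ℝ).const_smul r)

theorem continuousOn_comp_smul_ballInvolution (hr : 0 < r)
    (hu : ContinuousOn u (closedBall 0 r)) (ha : ‖a‖ < 1) :
    ContinuousOn (fun w => u (r • ballInvolution a w)) (closedBall 0 1) := by
  refine ContinuousOn.comp hu (fun w hw => ?_) fun w hw => ?_
  · exact ((contDiffAt_ballInvolution (k := 1) ha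
      (mem_closedBall_zero_iff.mp hw)).continuousAt.const_smul r).continuousWithinAt
  · exact smul_ballInvolution_mem_closedBall hr ha (mem_closedBall_zero_iff.mp hw)

/-- The complex Monge–Ampère equation is preserved by the automorphisms of the ball, up to the
squared modulus of the Jacobian determinant. -/
theorem cxHessian_comp_smul_ballInvolution (hn : 0 < n) (hr : 0 < r)
    (hu : ContDiffOn ℝ 2 u (ball 0 r))
    (hpsh : ∀ z ∈ ball (0 : EuclideanSpace ℂ (Fin n)) r, (cxHessian n u z).PosSemidef)
    (hdet : ∀ z ∈ ball (0 : EuclideanSpace ℂ (Fin n)) r,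
      (cxHessian n u z).det = ((g z ^ n : ℝ) : ℂ))
    (ha : ‖a‖ < 1) (hz : ‖z‖ < 1) :
    (cxHessian n (fun w => u (r • ballInvolution a w)) z).PosSemidef ∧
      (cxHessian n (fun w => u (r • ballInvolution a w)) z).det =
        (((r ^ 2 * ballInvolutionWeight a z * g (r • ballInvolution a z)) ^ n : ℝ) : ℂ) := by
  have hmem := smul_ballInvolution_mem_ball hr ha hz
  have hT : ContDiffAt ℂ 2 (ballInvolution a) z := contDiffAt_ballInvolution ha hz.le
  have hF : ContDiffAt ℂ 2 (fun w => (r : ℂ) • ballInvolution a w) z := hT.const_smul (r : ℂ)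
  have heq : (fun w => u (r • ballInvolution a w))
      = u ∘ fun w => (r : ℂ) • ballInvolution a w := by
    ext w; simp
  set J : Matrix (Fin n) (Fin n) ℂ := Matrix.of fun k i =>
    r * fderiv ℂ (ballInvolution a) z (EuclideanSpace.single i (1 : ℂ)) k with hJ
  have hfd : fderiv ℂ (fun w => (r : ℂ) • ballInvolution a w) z
      = (r : ℂ) • fderiv ℂ (ballInvolution a) z :=
    ((hT.differentiableAt (by norm_num)).hasFDerivAt.const_smul (r : ℂ)).fderiv
  have hsm : (r : ℂ) • ballInvolution a z = r • ballInvolution a z := by simp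
  have hcomp := cxHessian_comp (u := u) (F := fun w => (r : ℂ) • ballInvolution a w) (z := z)
    (J := J) (by rw [hsm]; exact hu.contDiffAt (isOpen_ball.mem_nhds hmem)) hF
    (fun k i => by rw [hfd]; simp [hJ])
  rw [hsm] at hcomp
  rw [heq, hcomp]
  have hJT : J.transpose = (J.map (starRingEnd ℂ)).conjTranspose := by
    ext i j; simp [Matrix.conjTranspose_apply]
  refine ⟨by rw [hJT]; exact (hpsh _ hmem).conjTranspose_mul_mul_same _, ?_⟩
  have hJc : (J.map (starRingEnd ℂ)).det = (starRingEnd ℂ) J.det :=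
    ((starRingEnd ℂ).map_det J).symm
  have hnorm := norm_det_ballInvolution_sq ha hz.le r (J := J) (fun k i => rfl)
  rw [← ballInvolutionWeight_pow hn ha] at hnorm
  rw [Matrix.det_mul, Matrix.det_mul, Matrix.det_transpose, hJc, hdet _ hmem, mul_right_comm,
    Complex.mul_conj, Complex.normSq_eq_norm_sq, hnorm, ← Complex.ofReal_mul, mul_pow, mul_pow]

/-- One-sided comparison of a solution of the complex Monge–Ampère equation on a ball with its
composition with two automorphisms of the ball. -/
theorem sub_le_of_ballInvolution_bounds (hn : 0 < n) (hr : 0 < r)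
    (hu : ContDiffOn ℝ 2 u (ball 0 r)) (huc : ContinuousOn u (closedBall 0 r))
    (hpsh : ∀ z ∈ ball (0 : EuclideanSpace ℂ (Fin n)) r, (cxHessian n u z).PosSemidef)
    (hdet : ∀ z ∈ ball (0 : EuclideanSpace ℂ (Fin n)) r,
      (cxHessian n u z).det = ((g z ^ n : ℝ) : ℂ))
    (hg : ∀ z ∈ ball (0 : EuclideanSpace ℂ (Fin n)) r, 0 ≤ g z)
    {a b : EuclideanSpace ℂ (Fin n)} (ha : ‖a‖ < 1) (hb : ‖b‖ < 1) {A D : ℝ} (hA : 0 ≤ A)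
    (hint : ∀ z : EuclideanSpace ℂ (Fin n), ‖z‖ < 1 →
      r ^ 2 * ballInvolutionWeight b z * g (r • ballInvolution b z)
        - r ^ 2 * ballInvolutionWeight a z * g (r • ballInvolution a z) ≤ A)
    (hbd : ∀ z : EuclideanSpace ℂ (Fin n), ‖z‖ = 1 →
      u (r • ballInvolution a z) - u (r • ballInvolution b z) ≤ D) :
    u (r • a) - u (r • b) ≤ A + D := by
  refine le_of_forall_pos_le_add fun ε hε => ?_
  set W : EuclideanSpace ℂ (Fin n) → ℝ := fun w =>
    u (r • ballInvolution a w) + (A + ε) * ‖w‖ ^ 2 - u (r • ballInvolution b w) with hW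
  have hWc : ContinuousOn W (closedBall 0 1) :=
    ((continuousOn_comp_smul_ballInvolution hr huc ha).add
      (by fun_prop)).sub (continuousOn_comp_smul_ballInvolution hr huc hb)
  obtain ⟨z, hz, hmax⟩ := (isCompact_closedBall (0 : EuclideanSpace ℂ (Fin n)) 1).exists_isMaxOn
    ⟨0, by simp⟩ hWc
  have hzero : u (r • a) - u (r • b) ≤ W z := by
    have : W 0 ≤ W z := hmax (by simp)
    simpa [hW] using this
  rcases (mem_closedBall_zero_iff.mp hz).lt_or_eq with h1 | h1
  · exfalso
    have hloc : IsLocalMax W z :=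
      hmax.isLocalMax (Filter.mem_of_superset (isOpen_ball.mem_nhds (mem_ball_zero_iff.mpr h1))
        ball_subset_closedBall)
    have hpos := cxHessian_sub_posSemidef_of_isLocalMax
      (contDiffAt_comp_smul_ballInvolution hr hu ha h1)
      (contDiffAt_comp_smul_ballInvolution hr hu hb h1) hloc
    have hG : ∀ c : EuclideanSpace ℂ (Fin n), ‖c‖ < 1 →
        0 ≤ r ^ 2 * ballInvolutionWeight c z * g (r • ballInvolution c z) := fun c hc =>
      mul_nonneg (mul_nonneg (by positivity) (ballInvolutionWeight_nonneg hc))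
        (hg _ (smul_ballInvolution_mem_ball hr hc h1))
    obtain ⟨p₁, d₁⟩ := cxHessian_comp_smul_ballInvolution hn hr hu hpsh hdet ha h1
    obtain ⟨-, d₂⟩ := cxHessian_comp_smul_ballInvolution hn hr hu hpsh hdet hb h1
    have := Matrix.PosSemidef.root_det_add_le (by simpa using hn) p₁ (by linarith : 0 < A + ε)
      hpos (hG a ha) (hG b hb) (by simpa using d₁) (by simpa using d₂)
    linarith [hint z h1]
  · have h2 := hbd z h1
    have h3 : W z = u (r • ballInvolution a z) - u (r • ballInvolution b z) + (A + ε) := by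
      simp only [hW, h1]; ring
    linarith

/-- The constant in a Hölder bound between two distinct points is nonnegative. -/
theorem nonneg_of_abs_le_mul_rpow {E : Type*} [NormedAddCommGroup E] {K α s : ℝ} {x y : E}
    (h : |s| ≤ K * ‖x - y‖ ^ α) (hxy : x ≠ y) : 0 ≤ K :=
  nonneg_of_mul_nonneg_left ((abs_nonneg _).trans h)
    (Real.rpow_pos_of_pos (norm_pos_iff.mpr (sub_ne_zero.mpr hxy)) _)

theorem abs_mul_sub_mul_le {w₁ w₂ g₁ g₂ W K V M : ℝ} (hw : |w₁ - w₂| ≤ W) (hg₁ : |g₁| ≤ K)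
    (hw₂ : |w₂| ≤ V) (hg : |g₁ - g₂| ≤ M) : |w₁ * g₁ - w₂ * g₂| ≤ W * K + V * M := by
  have : w₁ * g₁ - w₂ * g₂ = (w₁ - w₂) * g₁ + w₂ * (g₁ - g₂) := by ring
  rw [this]
  refine (abs_add_le _ _).trans (add_le_add ?_ ?_) <;> rw [abs_mul]
  · exact mul_le_mul hw hg₁ (abs_nonneg _) ((abs_nonneg _).trans hw)
  · exact mul_le_mul hw₂ hg (abs_nonneg _) ((abs_nonneg _).trans hw₂)

theorem holder_scaling_bound {L α r δ d Kφ K₀ K₁ : ℝ} (hL : 1 ≤ L) (hα : 0 < α) (hα1 : α ≤ 1)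
    (hr : 0 < r) (hδ0 : 0 ≤ δ) (hδ : δ ≤ 2) (hd : d = r * δ) (hφ : 0 ≤ Kφ) (h₀ : 0 ≤ K₀)
    (h₁ : 0 ≤ K₁) :
    r ^ 2 * (L * δ * K₀ + L * (K₁ * (r * (L * δ)) ^ α)) + Kφ * (r * (L * δ)) ^ α
      ≤ 2 * L ^ 2 * (Kφ + r ^ (2 - α) * (K₀ + r ^ α * K₁)) * d ^ α := by
  have hL0 : 0 < L := by linarith
  have hLα : L ^ α ≤ L := by
    simpa using Real.rpow_le_rpow_of_exponent_le hL hα1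
  have hδα : δ ≤ 2 * δ ^ α := by
    rcases hδ0.eq_or_lt with h | h
    · rw [← h]; positivity
    · have e : δ = δ ^ (1 - α) * δ ^ α := by rw [← Real.rpow_add h]; simp
      have e2 : δ ^ (1 - α) ≤ 2 := by
        calc δ ^ (1 - α) ≤ 2 ^ (1 - α) := Real.rpow_le_rpow h.le hδ (by linarith)
          _ ≤ 2 ^ (1 : ℝ) := Real.rpow_le_rpow_of_exponent_le (by norm_num) (by linarith)
          _ = 2 := by norm_num
      calc δ = δ ^ (1 - α) * δ ^ α := e
        _ ≤ 2 * δ ^ α := by gcongr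
  have hr2 : r ^ 2 = r ^ (2 - α) * r ^ α := by
    rw [← Real.rpow_add hr]; norm_num
  rw [hd, Real.mul_rpow hr.le (by positivity), Real.mul_rpow hL0.le hδ0,
    Real.mul_rpow hr.le hδ0, hr2]
  have hA : 0 < r ^ α := by positivity
  have hB : 0 < r ^ (2 - α) := by positivity
  have hX : 0 ≤ δ ^ α := by positivity
  generalize r ^ α = p at *
  generalize r ^ (2 - α) = q at *
  generalize δ ^ α = x at *
  generalize L ^ α = l at *
  have hLL : L ≤ L ^ 2 := by nlinarith
  have i1 : q * p * (L * δ * K₀) ≤ q * p * (L ^ 2 * (2 * x) * K₀) := by gcongr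
  have i2 : q * p * (L * (K₁ * (p * (l * x)))) ≤ q * p * (L * (K₁ * (p * (L * x)))) := by gcongr
  have i3 : Kφ * (p * (l * x)) ≤ Kφ * (p * (L ^ 2 * x)) := by
    have := hLα.trans hLL
    gcongr
  have i4 : 0 ≤ Kφ * (p * (L ^ 2 * x)) := by positivity
  have i5 : 0 ≤ q * p * (L * (K₁ * (p * (L * x)))) := by positivity
  linarith

end Dirichlet

/-- **Interior C^{0,α} estimate for the complex Monge–Ampère equation on a ball**
(Theorem 1.4). If `u ∈ PSH(B_r(0)) ∩ C(B̄_r(0))` is a (classical) solution of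
`det(u_{i j̄}) = f` in `B_r(0)`, `u = φ` on `∂B_r(0)`, with `φ ∈ C^{0,α}(∂B_r(0))`,
`f ≥ 0`, `f^{1/n} ∈ C^{0,α}(B̄_r(0))`, `α ∈ (0,1]`, then for every `t ∈ (0,1)`,
`[u]_{0,α;B_{(1-t)r}(0)} ≤ C(n,t) ([φ]_{0,α;∂B_r(0)} + r^{2-α} |f^{1/n}|'_{0,α;B_r(0)})`,
where `C(n,t)` depends only on `n` and `t`.  Sup-type seminorms are expressed
through arbitrary upper bounds: `Kφ` is a Hölder constant for `φ` on the sphere and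
`K₀, K₁` bound `sup |f^{1/n}|` and the Hölder seminorm `[f^{1/n}]_{0,α}` on `B_r`. -/
theorem interior_C0alpha_estimate (n : ℕ) (hn : 0 < n)
    (t : ℝ) (ht0 : 0 < t) (ht1 : t < 1) :
    ∃ C : ℝ, ∀ (α : ℝ), 0 < α → α ≤ 1 → ∀ (r : ℝ), 0 < r →
      ∀ u f g φ : EuclideanSpace ℂ (Fin n) → ℝ,
      -- u ∈ C²(B_r) ∩ C(B̄_r)
      ContDiffOn ℝ 2 u (ball 0 r) →
      ContinuousOn u (closedBall 0 r) →
      -- u is plurisubharmonic on B_r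
      (∀ z ∈ ball (0 : EuclideanSpace ℂ (Fin n)) r, (cxHessian n u z).PosSemidef) →
      -- the complex Monge-Ampère equation det(u_{i j̄}) = f in B_r
      (∀ z ∈ ball (0 : EuclideanSpace ℂ (Fin n)) r, (cxHessian n u z).det = (f z : ℂ)) →
      -- f ≥ 0 and g = f^{1/n}
      (∀ z ∈ closedBall (0 : EuclideanSpace ℂ (Fin n)) r, 0 ≤ f z) →
      (∀ z ∈ closedBall (0 : EuclideanSpace ℂ (Fin n)) r, g z = f z ^ ((n : ℝ)⁻¹)) →
      -- g = f^{1/n} ∈ C^{0,α}(B̄_r)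
      ContinuousOn g (closedBall 0 r) →
      -- φ is continuous on the sphere and u = φ on ∂B_r
      ContinuousOn φ (sphere 0 r) →
      (∀ z ∈ sphere (0 : EuclideanSpace ℂ (Fin n)) r, u z = φ z) →
      ∀ Kφ K₀ K₁ : ℝ,
      -- Kφ is a Hölder constant for φ on ∂B_r (so [φ]_{0,α;∂B_r} ≤ Kφ)
      (∀ x ∈ sphere (0 : EuclideanSpace ℂ (Fin n)) r,
        ∀ y ∈ sphere (0 : EuclideanSpace ℂ (Fin n)) r,
          |φ x - φ y| ≤ Kφ * ‖x - y‖ ^ α) →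
      -- K₀, K₁ bound the two pieces of |f^{1/n}|'_{0,α;B_r}
      (∀ x ∈ ball (0 : EuclideanSpace ℂ (Fin n)) r, |g x| ≤ K₀) →
      (∀ x ∈ ball (0 : EuclideanSpace ℂ (Fin n)) r,
        ∀ y ∈ ball (0 : EuclideanSpace ℂ (Fin n)) r,
          |g x - g y| ≤ K₁ * ‖x - y‖ ^ α) →
      -- conclusion: [u]_{0,α;B_{(1-t)r}} ≤ C(n,t)([φ]_{0,α;∂B_r} + r^{2-α}|f^{1/n}|'_{0,α;B_r})
      ∀ x ∈ ball (0 : EuclideanSpace ℂ (Fin n)) ((1 - t) * r),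
      ∀ y ∈ ball (0 : EuclideanSpace ℂ (Fin n)) ((1 - t) * r),
        |u x - u y| ≤ C * (Kφ + r ^ (2 - α) * (K₀ + r ^ α * K₁)) * ‖x - y‖ ^ α := by
  obtain ⟨L, hL, hbounds⟩ := exists_ballInvolution_bounds n (ρ := 1 - t) (by linarith)
  refine ⟨2 * L ^ 2, fun α hα hα1 r hr u f g φ hu huc hpsh hdet hf hg _ _ huφ Kφ K₀ K₁ hφ h₀ h₁ x
    hx y hy => ?_⟩
  have hsub : ball (0 : EuclideanSpace ℂ (Fin n)) r ⊆ closedBall 0 r := ball_subset_closedBall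
  have hg0 : ∀ z ∈ ball (0 : EuclideanSpace ℂ (Fin n)) r, 0 ≤ g z := fun z hz => by
    rw [hg z (hsub hz)]; exact Real.rpow_nonneg (hf z (hsub hz)) _
  have hdet' : ∀ z ∈ ball (0 : EuclideanSpace ℂ (Fin n)) r,
      (cxHessian n u z).det = ((g z ^ n : ℝ) : ℂ) := fun z hz => by
    rw [hdet z hz, hg z (hsub hz), Real.rpow_inv_natCast_pow (hf z (hsub hz)) hn.ne']
  have hr' : |r| = r := abs_of_pos hr
  set e : EuclideanSpace ℂ (Fin n) := EuclideanSpace.single ⟨0, hn⟩ (1 : ℂ) with he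
  have he1 : ‖e‖ = 1 := by simp [he]
  have he0 : e ≠ 0 := norm_ne_zero_iff.mp (by simp [he1])
  have hKφ : 0 ≤ Kφ := by
    refine nonneg_of_abs_le_mul_rpow (hφ (r • e) ?_ (-(r • e)) ?_) ?_
    · simp [norm_smul, he1, hr']
    · simp [norm_smul, he1, hr']
    · rw [ne_eq, eq_neg_iff_add_eq_zero, ← two_smul ℝ]
      exact smul_ne_zero two_ne_zero (smul_ne_zero hr.ne' he0)
  have hK₀ : 0 ≤ K₀ := (abs_nonneg _).trans (h₀ 0 (mem_ball_self hr))
  have hK₁ : 0 ≤ K₁ := by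
    refine nonneg_of_abs_le_mul_rpow (h₁ ((r / 2) • e) ?_ 0 (mem_ball_self hr)) ?_
    · simp only [mem_ball_zero_iff, norm_smul, he1, Real.norm_eq_abs, mul_one]
      rw [abs_of_pos (by linarith)]; linarith
    · exact smul_ne_zero (by linarith) he0
  have hsmul : ∀ c, r • (r⁻¹ • c) = c := fun c : EuclideanSpace ℂ (Fin n) => smul_inv_smul₀ hr.ne' c
  have hnorm : ∀ c ∈ ball (0 : EuclideanSpace ℂ (Fin n)) ((1 - t) * r), ‖r⁻¹ • c‖ ≤ 1 - t :=
    fun c hc => by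
      rw [norm_smul, norm_inv, Real.norm_eq_abs, hr', inv_mul_le_iff₀ hr, mul_comm]
      exact (mem_ball_zero_iff.mp hc).le
  have key : ∀ x ∈ ball (0 : EuclideanSpace ℂ (Fin n)) ((1 - t) * r),
      ∀ y ∈ ball (0 : EuclideanSpace ℂ (Fin n)) ((1 - t) * r),
      u x - u y ≤ 2 * L ^ 2 * (Kφ + r ^ (2 - α) * (K₀ + r ^ α * K₁)) * ‖x - y‖ ^ α := by
    intro x hx y hy
    obtain ⟨a, rfl⟩ : ∃ a, x = r • a := ⟨_, (hsmul x).symm⟩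
    obtain ⟨b, rfl⟩ : ∃ b, y = r • b := ⟨_, (hsmul y).symm⟩
    have ha := hnorm _ hx
    have hb := hnorm _ hy
    rw [inv_smul_smul₀ hr.ne'] at ha hb
    have ha1 : ‖a‖ < 1 := by linarith
    have hb1 : ‖b‖ < 1 := by linarith
    have hdist : ∀ z : EuclideanSpace ℂ (Fin n), ‖z‖ ≤ 1 →
        ‖r • ballInvolution a z - r • ballInvolution b z‖ ^ α ≤ (r * (L * ‖a - b‖)) ^ α := by
      intro z hz
      refine Real.rpow_le_rpow (norm_nonneg _) ?_ hα.le
      rw [← smul_sub, norm_smul, Real.norm_eq_abs, hr']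
      exact mul_le_mul_of_nonneg_left (hbounds a b z ha hb hz).1 hr.le
    refine (sub_le_of_ballInvolution_bounds hn hr hu huc hpsh hdet' hg0 ha1 hb1
      (A := r ^ 2 * (L * ‖a - b‖ * K₀ + L * (K₁ * (r * (L * ‖a - b‖)) ^ α)))
      (D := Kφ * (r * (L * ‖a - b‖)) ^ α) (by positivity) ?_ ?_).trans
      (holder_scaling_bound hL hα hα1 hr (norm_nonneg _) ?_ ?_ hKφ hK₀ hK₁)
    · intro z hz
      have hma := smul_ballInvolution_mem_ball hr ha1 hz
      have hmb := smul_ballInvolution_mem_ball hr hb1 hz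
      rw [mul_assoc, mul_assoc, ← mul_sub]
      refine mul_le_mul_of_nonneg_left ((le_abs_self _).trans ?_) (by positivity)
      refine abs_mul_sub_mul_le ?_ (h₀ _ hmb) ?_ ((h₁ _ hmb _ hma).trans ?_)
      · rw [abs_sub_comm]
        exact (hbounds a b z ha hb hz.le).2.1
      · rw [abs_of_nonneg (ballInvolutionWeight_nonneg ha1)]
        exact (hbounds a b z ha hb hz.le).2.2
      · rw [norm_sub_rev]
        exact mul_le_mul_of_nonneg_left (hdist z hz.le) hK₁
    · intro z hz
      have hma := smul_ballInvolution_mem_sphere hr ha1 hz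
      have hmb := smul_ballInvolution_mem_sphere hr hb1 hz
      rw [huφ _ hma, huφ _ hmb]
      exact (le_abs_self _).trans ((hφ _ hma _ hmb).trans
        (mul_le_mul_of_nonneg_left (hdist z hz.le) hKφ))
    · linarith [norm_sub_le a b]
    · rw [← smul_sub, norm_smul, Real.norm_eq_abs, hr']
  refine abs_le.mpr ⟨?_, key x hx y hy⟩
  have := key y hy x hx
  rw [norm_sub_rev] at this
  linarith
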